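/- Let X ⊆ ℂⁿ be a compact set and let 1 ≤ q ≤ n. Suppose X = ⋃_{k=1}^∞ X_k, where each X_k is compact and satisfies Property (P_q). Then X satisfies Property (P_q). -/

import Mathlib

open MeasureTheory Metric Filter

noncomputable section

/-- The Wirtinger derivative `∂f/∂z_j` of `f : ℂ^n → ℂ` at `z`. -/
def wirtingerDz (n : ℕ) (f : EuclideanSpace ℂ (Fin n) → ℂ) (j : Fin n)
    (z : EuclideanSpace ℂ (Fin n)) : ℂ :=
  (1 / 2) * (fderiv ℝ f z (EuclideanSpace.single j 1)
    - Complex.I * fderiv ℝ f z (EuclideanSpace.single j Complex.I))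

/-- The Wirtinger derivative `∂f/∂z̄_k` of `f : ℂ^n → ℂ` at `z`. -/
def wirtingerDzbar (n : ℕ) (f : EuclideanSpace ℂ (Fin n) → ℂ) (k : Fin n)
    (z : EuclideanSpace ℂ (Fin n)) : ℂ :=
  (1 / 2) * (fderiv ℝ f z (EuclideanSpace.single k 1)
    + Complex.I * fderiv ℝ f z (EuclideanSpace.single k Complex.I))

/-- The complex Hessian `L_φ(z) = (∂²φ/∂z_j ∂z̄_k)_{j,k}` of a real-valued function `φ`. -/
def leviMatrix (n : ℕ) (φ : EuclideanSpace ℂ (Fin n) → ℝ)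
    (z : EuclideanSpace ℂ (Fin n)) : Matrix (Fin n) (Fin n) ℂ :=
  fun j k => wirtingerDz n (fun w => wirtingerDzbar n (fun v => (φ v : ℂ)) k w) j z

/-- Property `(P_q)`: for every `M > 0` there are an open neighborhood `U` of `X` and a `C²`
function `φ : U → [0,1]` such that at every point of `U` the sum of the `q` smallest
eigenvalues of the (Hermitian) complex Hessian of `φ` is at least `M`; equivalently, every
sum of `q` of its eigenvalues is at least `M`. -/
def HasPropertyPq (n q : ℕ) (X : Set (EuclideanSpace ℂ (Fin n))) : Prop :=
  ∀ M > (0 : ℝ), ∃ (U : Set (EuclideanSpace ℂ (Fin n))) (φ : EuclideanSpace ℂ (Fin n) → ℝ),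
    IsOpen U ∧ X ⊆ U ∧ ContDiffOn ℝ 2 φ U ∧ (∀ z ∈ U, φ z ∈ Set.Icc (0 : ℝ) 1) ∧
    ∀ z ∈ U, ∃ hH : (leviMatrix n φ z).IsHermitian,
      ∀ s : Finset (Fin n), s.card = q → M ≤ ∑ j ∈ s, hH.eigenvalues j


abbrev EE (n : ℕ) := EuclideanSpace ℂ (Fin n)

/-- fractional choice bound -/
lemma frac_bound {n q : ℕ} (hq : 1 ≤ q) (hqn : q ≤ n) (l c : Fin n → ℝ) (M : ℝ)
    (h0 : ∀ j, 0 ≤ c j) (h1 : ∀ j, c j ≤ 1) (hs : ∑ j, c j = q)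
    (hM : ∀ s : Finset (Fin n), s.card = q → M ≤ ∑ j ∈ s, l j) :
    M ≤ ∑ j, l j * c j := by
  obtain ⟨s, hsm, hmin⟩ := Finset.exists_min_image
    (Finset.powersetCard q (Finset.univ : Finset (Fin n))) (fun s => ∑ j ∈ s, l j)
    (Finset.powersetCard_nonempty.2 (by simpa using hqn))
  have hsc : s.card = q := (Finset.mem_powersetCard.1 hsm).2
  have hsne : s.Nonempty := Finset.card_pos.1 (by omega)
  obtain ⟨i, his, himax⟩ := Finset.exists_max_image s l hsne
  have hout : ∀ j, j ∉ s → l i ≤ l j := by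
    intro j hj
    have hj' : j ∉ s.erase i := fun h => hj (Finset.mem_of_mem_erase h)
    have := hmin (insert j (s.erase i)) (by
      rw [Finset.mem_powersetCard]
      refine ⟨Finset.subset_univ _, ?_⟩
      rw [Finset.card_insert_of_notMem hj', Finset.card_erase_of_mem his]; omega)
    rw [Finset.sum_insert hj', ← Finset.add_sum_erase s l his] at this
    linarith
  have key : ∀ j, l i * (c j - if j ∈ s then 1 else 0) ≤ l j * c j - if j ∈ s then l j else 0 := by
    intro j
    by_cases hj : j ∈ s
    · simp only [hj, if_true]
      nlinarith [himax j hj, h1 j]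
    · simp only [hj, if_false]
      nlinarith [hout j hj, h0 j]
  have := Finset.sum_le_sum (s := Finset.univ) (fun j _ => key j)
  rw [← Finset.mul_sum, Finset.sum_sub_distrib, Finset.sum_sub_distrib, hs] at this
  simp only [Finset.sum_ite_mem, Finset.univ_inter, Finset.sum_const, hsc] at this
  have h3 := hM s hsc
  simp at this
  linarith

lemma herm_inner {n : ℕ} {A : Matrix (Fin n) (Fin n) ℂ} (hA : A.IsHermitian) (v : EE n) :
    (inner ℂ v (A.toEuclideanLin v)).re
      = ∑ j, hA.eigenvalues j * ‖inner ℂ (hA.eigenvectorBasis j) v‖ ^ 2 := by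
  rw [← OrthonormalBasis.sum_inner_mul_inner hA.eigenvectorBasis, Complex.re_sum]
  refine Finset.sum_congr rfl fun j _ => ?_
  have hs := (Matrix.isSymmetric_toEuclideanLin_iff (A := A)).2 hA
  have he : A.toEuclideanLin (hA.eigenvectorBasis j)
      = (hA.eigenvalues j : ℂ) • hA.eigenvectorBasis j := by
    ext i
    have := congrFun (hA.mulVec_eigenvectorBasis j) i
    simpa [Matrix.toLpLin_apply] using this
  rw [← hs, he, inner_smul_left, ← inner_conj_symm v]
  have h2 : (starRingEnd ℂ) (inner ℂ (hA.eigenvectorBasis j) v) *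
      (inner ℂ (hA.eigenvectorBasis j) v) = ((‖inner ℂ (hA.eigenvectorBasis j) v‖ ^ 2 : ℝ) : ℂ) := by
    rw [mul_comm, Complex.mul_conj, Complex.normSq_eq_norm_sq]
  rw [mul_left_comm, h2, Complex.conj_ofReal, ← Complex.ofReal_mul, Complex.ofReal_re]

lemma eig_iff {n q : ℕ} (hq : 1 ≤ q) (hqn : q ≤ n) {A : Matrix (Fin n) (Fin n) ℂ}
    (hA : A.IsHermitian) (M : ℝ) :
    (∀ s : Finset (Fin n), s.card = q → M ≤ ∑ j ∈ s, hA.eigenvalues j) ↔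
    ∀ v : Fin q → EE n, Orthonormal ℂ v → M ≤ ∑ i, (inner ℂ (v i) (A.toEuclideanLin (v i))).re := by
  constructor
  · intro h v hv
    simp_rw [herm_inner hA]
    rw [Finset.sum_comm]
    simp_rw [← Finset.mul_sum]
    refine frac_bound hq hqn _ _ M (fun j => by positivity) (fun j => ?_) ?_ h
    · have := hv.sum_inner_products_le (hA.eigenvectorBasis j) (s := Finset.univ)
      simp_rw [norm_inner_symm (hA.eigenvectorBasis j)]
      simpa using this
    · rw [Finset.sum_comm]
      simp_rw [OrthonormalBasis.sum_sq_norm_inner_right, hv.1]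
      simp
  · intro h s hs
    let e := (s.orderIsoOfFin hs)
    have := h (fun i => hA.eigenvectorBasis (e i)) (hA.eigenvectorBasis.orthonormal.comp _
      (Subtype.val_injective.comp e.injective))
    refine this.trans (le_of_eq ?_)
    rw [← Finset.sum_coe_sort s, ← Equiv.sum_comp e.toEquiv]
    refine Finset.sum_congr rfl fun i _ => ?_
    rw [herm_inner hA]
    simp_rw [OrthonormalBasis.inner_eq_ite]
    rw [Finset.sum_eq_single (e i : Fin n)]
    · simp
    · intro b _ hb
      simp [hb]
    · simp

/-- second derivative -/
def D2 {n : ℕ} (φ : EE n → ℝ) (z : EE n) (x y : EE n) : ℝ := fderiv ℝ (fderiv ℝ φ) z x y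

def lev {n : ℕ} (φ : EE n → ℝ) (z : EE n) (w : EE n) : ℝ :=
  (1 / 4) * (D2 φ z w w + D2 φ z (Complex.I • w) (Complex.I • w))

lemma levi_entry {n : ℕ} {φ : EE n → ℝ} {z : EE n} (h : ContDiffAt ℝ 2 φ z) (j k : Fin n) :
    leviMatrix n φ z j k = (1 / 4) *
      ((D2 φ z (EuclideanSpace.single j 1) (EuclideanSpace.single k 1) +
        D2 φ z (EuclideanSpace.single j Complex.I) (EuclideanSpace.single k Complex.I) : ℝ) +
       Complex.I * (D2 φ z (EuclideanSpace.single j 1) (EuclideanSpace.single k Complex.I) -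
        D2 φ z (EuclideanSpace.single j Complex.I) (EuclideanSpace.single k 1) : ℝ)) := by
  have h1 : ∀ᶠ w in nhds z, ContDiffAt ℝ 2 φ w := h.eventually (by simp)
  have h2 : DifferentiableAt ℝ (fderiv ℝ φ) z :=
    (h.fderiv_right (m := 1) (by norm_num)).differentiableAt (by norm_num)
  have hd : ∀ x : EE n, HasFDerivAt (fun w => ((fderiv ℝ φ w x : ℝ) : ℂ))
      (Complex.ofRealCLM.comp ((ContinuousLinearMap.apply ℝ ℝ x).comp (fderiv ℝ (fderiv ℝ φ) z))) z := by
    intro x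
    exact Complex.ofRealCLM.hasFDerivAt.comp z
      ((ContinuousLinearMap.apply ℝ ℝ x).hasFDerivAt.comp z h2.hasFDerivAt)
  have he : (fun w => wirtingerDzbar n (fun v => (φ v : ℂ)) k w) =ᶠ[nhds z]
      fun w => (1 / 2 : ℂ) * ((fderiv ℝ φ w (EuclideanSpace.single k 1) : ℝ)
        + Complex.I * (fderiv ℝ φ w (EuclideanSpace.single k Complex.I) : ℝ)) := by
    filter_upwards [h1] with w hw
    have hw' : HasFDerivAt (fun v => (φ v : ℂ)) (Complex.ofRealCLM.comp (fderiv ℝ φ w)) w :=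
      Complex.ofRealCLM.hasFDerivAt.comp w (hw.differentiableAt (by norm_num)).hasFDerivAt
    unfold wirtingerDzbar
    rw [hw'.fderiv]
    simp
  have hf := ((hd (EuclideanSpace.single k 1)).add
    ((hd (EuclideanSpace.single k Complex.I)).const_mul Complex.I)).const_mul (1 / 2 : ℂ)
  unfold leviMatrix wirtingerDz
  rw [he.fderiv_eq]
  have hf' := hf.fderiv
  simp only [Pi.add_def] at hf'
  rw [hf']
  simp only [D2, smul_apply, add_apply,
    ContinuousLinearMap.comp_apply, Complex.ofRealCLM_apply, ContinuousLinearMap.apply_apply,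
    smul_eq_mul, Complex.ofReal_add, Complex.ofReal_sub]
  linear_combination (-(1/4) * (((fderiv ℝ (fderiv ℝ φ) z) (EuclideanSpace.single j Complex.I)
    (EuclideanSpace.single k Complex.I) : ℝ) : ℂ)) * Complex.I_sq

lemma D2_symm {n : ℕ} {φ : EE n → ℝ} {z : EE n} (h : ContDiffAt ℝ 2 φ z) (x y : EE n) :
    D2 φ z x y = D2 φ z y x :=
  h.isSymmSndFDerivAt (by simp) x y

lemma levi_herm {n : ℕ} {φ : EE n → ℝ} {z : EE n} (h : ContDiffAt ℝ 2 φ z) :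
    (leviMatrix n φ z).IsHermitian := by
  ext j k
  rw [Matrix.conjTranspose_apply, levi_entry h, levi_entry h]
  simp only [D2_symm h (EuclideanSpace.single k _) _]
  apply Complex.ext <;> simp

/-- the sesquilinear form -/
def SS {n : ℕ} (φ : EE n → ℝ) (z : EE n) (x y : EE n) : ℂ :=
  (1 / 4) * ((D2 φ z x y + D2 φ z (Complex.I • x) (Complex.I • y) : ℝ) +
       Complex.I * (D2 φ z x (Complex.I • y) - D2 φ z (Complex.I • x) y : ℝ))

lemma SS_smul_left {n : ℕ} (φ : EE n → ℝ) (z : EE n) (c : ℂ) (x y : EE n) :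
    SS φ z (c • x) y = c * SS φ z x y := by
  have h1 : c • x = c.re • x + c.im • (Complex.I • x) := by
    ext i; apply Complex.ext <;> simp <;> ring
  have h2 : Complex.I • c • x = c.re • (Complex.I • x) + (- c.im) • x := by
    ext i; apply Complex.ext <;> simp <;> ring
  unfold SS
  rw [h2, h1]
  simp only [D2, map_add, map_smul, add_apply, smul_apply,
    smul_eq_mul]
  apply Complex.ext <;> simp <;> ring

lemma SS_smul_right {n : ℕ} (φ : EE n → ℝ) (z : EE n) (c : ℂ) (x y : EE n) :
    SS φ z x (c • y) = star c * SS φ z x y := by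
  have h1 : c • y = c.re • y + c.im • (Complex.I • y) := by
    ext i; apply Complex.ext <;> simp <;> ring
  have h2 : Complex.I • c • y = c.re • (Complex.I • y) + (- c.im) • y := by
    ext i; apply Complex.ext <;> simp <;> ring
  unfold SS
  rw [h2, h1]
  simp only [D2, map_add, map_smul, smul_eq_mul]
  apply Complex.ext <;> simp <;> ring

lemma SS_sum_left {n : ℕ} (φ : EE n → ℝ) (z : EE n) (x : Fin n → EE n) (y : EE n) :
    SS φ z (∑ j, x j) y = ∑ j, SS φ z (x j) y := by
  simp only [SS, D2, Finset.smul_sum, map_sum, sum_apply]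
  rw [← Finset.mul_sum, Finset.sum_add_distrib, ← Finset.mul_sum]
  push_cast
  simp only [Finset.sum_add_distrib, Finset.sum_sub_distrib]

lemma SS_sum_right {n : ℕ} (φ : EE n → ℝ) (z : EE n) (x : EE n) (y : Fin n → EE n) :
    SS φ z x (∑ j, y j) = ∑ j, SS φ z x (y j) := by
  simp only [SS, D2, Finset.smul_sum, map_sum]
  rw [← Finset.mul_sum, Finset.sum_add_distrib, ← Finset.mul_sum]
  push_cast
  simp only [Finset.sum_add_distrib, Finset.sum_sub_distrib]

def cj {n : ℕ} (v : EE n) : EE n := WithLp.toLp 2 (fun i => star (v i))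

lemma cj_cj {n : ℕ} (v : EE n) : cj (cj v) = v := by ext i; simp [cj]

lemma cj_orth {n q : ℕ} {v : Fin q → EE n} (hv : Orthonormal ℂ v) :
    Orthonormal ℂ (fun i => cj (v i)) := by
  rw [orthonormal_iff_ite] at hv ⊢
  intro i j
  have := congrArg star (hv i j)
  simp only [PiLp.inner_apply] at this ⊢
  simp only [cj]
  rw [star_sum] at this
  convert! this using 1
  · refine Finset.sum_congr rfl fun k _ => ?_
    simp [mul_comm]
  · split_ifs <;> simp

lemma levi_inner {n : ℕ} {φ : EE n → ℝ} {z : EE n} (h : ContDiffAt ℝ 2 φ z) (v : EE n) :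
    (inner ℂ v ((leviMatrix n φ z).toEuclideanLin v)).re = lev φ z (cj v) := by
  have hL : ∀ j k, leviMatrix n φ z j k
      = SS φ z (EuclideanSpace.single j 1) (EuclideanSpace.single k 1) := by
    intro j k
    have hI : ∀ j : Fin n, (EuclideanSpace.single j Complex.I : EE n)
        = Complex.I • EuclideanSpace.single j (1 : ℂ) := by
      intro j
      ext i
      simp [Pi.single_apply]
    rw [levi_entry h, SS, hI, hI]
  have hc : cj v = ∑ j, star (v j) • (EuclideanSpace.single j (1:ℂ) : EE n) := by
    ext i
    simp [cj, Finset.sum_apply, Pi.single_apply]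
  have h1 : inner ℂ v ((leviMatrix n φ z).toEuclideanLin v) = SS φ z (cj v) (cj v) := by
    rw [hc, SS_sum_left]
    simp_rw [SS_sum_right, SS_smul_left, SS_smul_right, ← hL]
    rw [PiLp.inner_apply]
    refine Finset.sum_congr rfl fun j _ => ?_
    simp only [Matrix.toLpLin_apply, Matrix.mulVec, dotProduct, RCLike.inner_apply,
      Finset.sum_mul, star_star]
    refine Finset.sum_congr rfl fun k _ => ?_
    simp
    ring
  rw [h1]
  simp [SS, lev, D2_symm h (Complex.I • cj v) (cj v)]

/-- trace lower bound over frames -/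
def TT {n : ℕ} (q : ℕ) (φ : EE n → ℝ) (z : EE n) (M : ℝ) : Prop :=
  ∀ v : Fin q → EE n, Orthonormal ℂ v → M ≤ ∑ i, lev φ z (v i)

lemma levi_iff {n q : ℕ} (hq : 1 ≤ q) (hqn : q ≤ n) {φ : EE n → ℝ} {z : EE n}
    (h : ContDiffAt ℝ 2 φ z) (M : ℝ) :
    (∃ hH : (leviMatrix n φ z).IsHermitian,
      ∀ s : Finset (Fin n), s.card = q → M ≤ ∑ j ∈ s, hH.eigenvalues j) ↔ TT q φ z M := by
  have hA := levi_herm h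
  rw [exists_prop_of_true hA, eig_iff hq hqn]
  simp_rw [levi_inner h]
  constructor
  · intro H v hv
    simpa [cj_cj] using H _ (cj_orth hv)
  · intro H v hv
    exact H _ (cj_orth hv)

lemma D2_congr {n : ℕ} {φ ψ : EE n → ℝ} {z : EE n} (h : φ =ᶠ[nhds z] ψ) : D2 φ z = D2 ψ z := by
  unfold D2
  rw [(h.fderiv (𝕜 := ℝ)).fderiv_eq]

lemma lev_congr {n : ℕ} {φ ψ : EE n → ℝ} {z : EE n} (h : φ =ᶠ[nhds z] ψ) :
    lev φ z = lev ψ z := by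
  unfold lev
  rw [D2_congr h]

lemma TT_congr {n q : ℕ} {φ ψ : EE n → ℝ} {z : EE n} {M : ℝ} (h : φ =ᶠ[nhds z] ψ)
    (H : TT q ψ z M) : TT q φ z M := by
  unfold TT at *
  rwa [lev_congr h]

lemma diff_fderiv {n : ℕ} {φ : EE n → ℝ} {z : EE n} (h : ContDiffAt ℝ 2 φ z) :
    DifferentiableAt ℝ (fderiv ℝ φ) z :=
  (h.fderiv_right (m := 1) (by norm_num)).differentiableAt (by norm_num)

lemma D2_add {n : ℕ} {φ ψ : EE n → ℝ} {z : EE n} (h : ContDiffAt ℝ 2 φ z)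
    (h' : ContDiffAt ℝ 2 ψ z) (x y : EE n) :
    D2 (fun w => φ w + ψ w) z x y = D2 φ z x y + D2 ψ z x y := by
  have h1 : ∀ᶠ w in nhds z, ContDiffAt ℝ 2 φ w := h.eventually (by simp)
  have h2 : ∀ᶠ w in nhds z, ContDiffAt ℝ 2 ψ w := h'.eventually (by simp)
  have he : fderiv ℝ (fun w => φ w + ψ w) =ᶠ[nhds z] fun w => fderiv ℝ φ w + fderiv ℝ ψ w := by
    filter_upwards [h1, h2] with w hw hw'
    exact fderiv_fun_add (hw.differentiableAt (by norm_num)) (hw'.differentiableAt (by norm_num))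
  unfold D2
  rw [he.fderiv_eq, fderiv_fun_add (diff_fderiv h) (diff_fderiv h')]
  rfl

lemma TT_add {n q : ℕ} {φ ψ : EE n → ℝ} {z : EE n} {M M' : ℝ} (h : ContDiffAt ℝ 2 φ z)
    (h' : ContDiffAt ℝ 2 ψ z) (H : TT q φ z M) (H' : TT q ψ z M') :
    TT q (fun w => φ w + ψ w) z (M + M') := by
  intro v hv
  have := add_le_add (H v hv) (H' v hv)
  refine this.trans (le_of_eq ?_)
  rw [← Finset.sum_add_distrib]
  refine Finset.sum_congr rfl fun i _ => ?_
  simp only [lev, D2_add h h']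
  ring

lemma D2_comp {n : ℕ} {k k1 k2 : ℝ → ℝ} (hk : ∀ t, HasDerivAt k (k1 t) t)
    (hk1 : ∀ t, HasDerivAt k1 (k2 t) t) {g : EE n → ℝ} {z : EE n}
    (h : ContDiffAt ℝ 2 g z) (x y : EE n) :
    D2 (fun w => k (g w)) z x y
      = k1 (g z) * D2 g z x y + k2 (g z) * fderiv ℝ g z x * fderiv ℝ g z y := by
  have h1 : ∀ᶠ w in nhds z, ContDiffAt ℝ 2 g w := h.eventually (by simp)
  have he : fderiv ℝ (fun w => k (g w)) =ᶠ[nhds z] fun w => k1 (g w) • fderiv ℝ g w := by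
    filter_upwards [h1] with w hw
    exact ((hk (g w)).comp_hasFDerivAt w (hw.differentiableAt (by norm_num)).hasFDerivAt).fderiv
  have h3 := ((hk1 (g z)).comp_hasFDerivAt z (h.differentiableAt (by norm_num)).hasFDerivAt).fun_smul
    (diff_fderiv h).hasFDerivAt
  unfold D2
  rw [he.fderiv_eq]
  have h4 := h3.fderiv
  simp only [Function.comp_apply] at h4
  rw [h4]
  simp

lemma TT_comp {n q : ℕ} {k k1 k2 : ℝ → ℝ} (hk : ∀ t, HasDerivAt k (k1 t) t)
    (hk1 : ∀ t, HasDerivAt k1 (k2 t) t) (h0 : ∀ t, 0 ≤ k1 t) (h2 : ∀ t, 0 ≤ k2 t)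
    {g : EE n → ℝ} {z : EE n} {M : ℝ}
    (h : ContDiffAt ℝ 2 g z) (H : TT q g z M) : TT q (fun w => k (g w)) z (k1 (g z) * M) := by
  intro v hv
  refine (mul_le_mul_of_nonneg_left (H v hv) (h0 _)).trans ?_
  rw [Finset.mul_sum]
  refine Finset.sum_le_sum fun i _ => ?_
  simp only [lev, D2_comp hk hk1 h]
  have a := mul_nonneg (h2 (g z)) (mul_self_nonneg (fderiv ℝ g z (v i)))
  have b := mul_nonneg (h2 (g z)) (mul_self_nonneg (fderiv ℝ g z (Complex.I • v i)))
  nlinarith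

lemma TT_mono {n q : ℕ} {φ : EE n → ℝ} {z : EE n} {M M' : ℝ} (hM : M' ≤ M)
    (H : TT q φ z M) : TT q φ z M' := fun v hv => hM.trans (H v hv)

lemma TT_bound {n : ℕ} (q : ℕ) {f : EE n → ℝ} (hf : ContDiff ℝ 2 f) {K : Set (EE n)}
    (hK : IsCompact K) : ∃ C : ℝ, 0 ≤ C ∧ ∀ z ∈ K, TT q f z (-C) := by
  have hc : Continuous (fderiv ℝ (fderiv ℝ f)) :=
    ((hf.fderiv_right (m := 1) (by norm_num)).continuous_fderiv (by norm_num))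
  have hcn : Continuous (fun z => ‖fderiv ℝ (fderiv ℝ f) z‖) :=
    (continuous_norm (E := EE n →L[ℝ] EE n →L[ℝ] ℝ)).comp hc
  obtain ⟨C, hC⟩ := hK.exists_bound_of_continuousOn hcn.continuousOn
  refine ⟨q * |C|, by positivity, fun z hz v hv => ?_⟩
  have key : ∀ w : EE n, ‖w‖ = 1 → -|C| ≤ D2 f z w w := by
    intro w hw
    have h1 := (fderiv ℝ (fderiv ℝ f) z).le_opNorm₂ w w
    rw [hw, mul_one, mul_one] at h1
    have hC' := (Real.le_norm_self _).trans (hC z hz)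
    have h2 := (h1.trans hC').trans (le_abs_self C)
    rw [Real.norm_eq_abs] at h2
    exact (abs_le.1 h2).1
  have : ∀ i ∈ Finset.univ, -|C| ≤ lev f z (v i) := by
    intro i _
    have a := key (v i) (hv.1 i)
    have b := key (Complex.I • v i) (by rw [norm_smul, hv.1 i]; simp)
    unfold lev
    have := abs_nonneg C
    linarith
  have := Finset.card_nsmul_le_sum _ _ _ this
  simpa using this

/-- the cutoff cube -/
def kk (t : ℝ) : ℝ := (max t 0) ^ 3
def kk1 (t : ℝ) : ℝ := 3 * (max t 0) ^ 2
def kk2 (t : ℝ) : ℝ := 6 * max t 0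

lemma maxpow_deriv (m : ℕ) (hm : 1 ≤ m) (t : ℝ) :
    HasDerivAt (fun s : ℝ => (max s 0) ^ (m + 1)) ((m + 1) * (max t 0) ^ m) t := by
  rcases lt_trichotomy t 0 with h | h | h
  · have : (fun s : ℝ => (max s 0) ^ (m + 1)) =ᶠ[nhds t] fun _ => 0 := by
      filter_upwards [gt_mem_nhds h] with s hs
      simp [max_eq_right hs.le]
    rw [max_eq_right h.le, zero_pow (by omega), mul_zero]
    exact (hasDerivAt_const t (0 : ℝ)).congr_of_eventuallyEq this
  · subst h
    have : (fun s : ℝ => (max s 0) ^ (m + 1)) =O[nhds 0] fun x => ‖x - 0‖ ^ (m + 1) := by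
      refine Asymptotics.IsBigO.of_bound 1 (Eventually.of_forall fun s => ?_)
      have : ‖max s 0‖ ≤ ‖s‖ := by
        rw [Real.norm_eq_abs, Real.norm_eq_abs, abs_of_nonneg (le_max_right _ _)]
        exact max_le (le_abs_self _) (abs_nonneg _)
      rw [norm_pow, norm_pow, norm_norm, one_mul, sub_zero]
      gcongr
    have h2 := this.hasFDerivAt (𝕜 := ℝ) (by omega)
    have h3 := h2.hasDerivAt
    simpa [zero_pow (show m ≠ 0 by omega)] using h3
  · have : (fun s : ℝ => (max s 0) ^ (m + 1)) =ᶠ[nhds t] fun s => s ^ (m + 1) := by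
      filter_upwards [lt_mem_nhds h] with s hs
      simp [max_eq_left (le_of_lt hs)]
    rw [max_eq_left h.le]
    have h2 := hasDerivAt_pow (m + 1) t
    simp only [Nat.cast_add, Nat.cast_one, Nat.add_sub_cancel] at h2
    exact h2.congr_of_eventuallyEq this

lemma kk_deriv (t : ℝ) : HasDerivAt kk (kk1 t) t := by
  have := maxpow_deriv 2 (by norm_num) t
  norm_num at this
  exact this

lemma kk1_deriv (t : ℝ) : HasDerivAt kk1 (kk2 t) t := by
  have := (maxpow_deriv 1 (by norm_num) t).const_mul 3
  norm_num at this
  have h2 : kk2 t = 3 * (2 * max t 0) := by unfold kk2; ring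
  rw [h2]
  exact this

lemma kk_contDiff : ContDiff ℝ 2 kk := by
  have h1 : deriv kk = kk1 := funext fun t => (kk_deriv t).deriv
  have h2 : deriv kk1 = kk2 := funext fun t => (kk1_deriv t).deriv
  have h3 : Continuous kk2 := by unfold kk2; fun_prop
  have h4 : ContDiff ℝ 1 kk1 := by
    rw [contDiff_one_iff_deriv, h2]
    exact ⟨fun t => (kk1_deriv t).differentiableAt, h3⟩
  rw [show (2 : WithTop ℕ∞) = 1 + 1 by norm_num, contDiff_succ_iff_deriv, h1]
  exact ⟨fun t => (kk_deriv t).differentiableAt, by simp, h4⟩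

def HasM {n : ℕ} (q : ℕ) (X : Set (EE n)) (M c : ℝ) : Prop :=
  ∃ (U : Set (EE n)) (φ : EE n → ℝ),
    IsOpen U ∧ X ⊆ U ∧ ContDiffOn ℝ 2 φ U ∧ (∀ z ∈ U, φ z ∈ Set.Icc (0 : ℝ) c) ∧
    ∀ z ∈ U, TT q φ z M

lemma pq_iff {n q : ℕ} (hq : 1 ≤ q) (hqn : q ≤ n) (X : Set (EE n)) :
    HasPropertyPq n q X ↔ ∀ M > 0, HasM q X M 1 := by
  unfold HasPropertyPq HasM
  refine forall_congr' fun M => forall_congr' fun hM => exists_congr fun U => exists_congr fun φ => ?_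
  refine and_congr_right fun hU => and_congr_right fun _ => and_congr_right fun hφ =>
    and_congr_right fun _ => forall_congr' fun z => forall_congr' fun hz => ?_
  exact levi_iff hq hqn (hφ.contDiffAt (hU.mem_nhds hz)) M

lemma HasM_scale {n q : ℕ} {X : Set (EE n)} {M c : ℝ} (hc : 0 < c) (h : HasM q X (c * M) c) :
    HasM q X M 1 := by
  obtain ⟨U, φ, hU, hX, hφ, hr, hT⟩ := h
  refine ⟨U, fun w => c⁻¹ * φ w, hU, hX, contDiffOn_const.mul hφ, fun z hz => ?_, fun z hz => ?_⟩
  · have := hr z hz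
    refine ⟨mul_nonneg (by positivity) this.1, ?_⟩
    rw [inv_mul_le_iff₀ hc, mul_one]
    exact this.2
  · have := TT_comp (k := fun t => c⁻¹ * t) (k1 := fun _ => c⁻¹) (k2 := fun _ => 0)
      (fun t => by simpa using (hasDerivAt_id t).const_mul c⁻¹) (fun t => hasDerivAt_const t _)
      (fun t => by positivity) (fun t => le_rfl) (hφ.contDiffAt (hU.mem_nhds hz)) (hT z hz)
    rwa [inv_mul_cancel_left₀ hc.ne'] at this

lemma cutoff {n : ℕ} {Y V : Set (EE n)} (hY : IsCompact Y) (hV : IsOpen V) (h : Y ⊆ V) :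
    ∃ (χ : EE n → ℝ) (O : Set (EE n)), ContDiff ℝ 2 χ ∧ (∀ z, χ z ∈ Set.Icc (0 : ℝ) 1) ∧
      tsupport χ ⊆ V ∧ IsOpen O ∧ Y ⊆ O ∧ ∀ z ∈ O, χ z = 1 := by
  obtain ⟨K1, hK1, hY1, h1V⟩ := exists_compact_between hY hV h
  obtain ⟨K2, hK2, hY2, h21⟩ := exists_compact_between hY isOpen_interior hY1
  obtain ⟨f, hf, hr, hs, ht⟩ := exists_contMDiff_support_eq_eq_one_iff
    (modelWithCornersSelf ℝ (EE n)) (n := 2) (isOpen_interior (s := K1)) hK2.isClosed h21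
  refine ⟨f, interior K2, hf.contDiff, fun z => hr ⟨z, rfl⟩, ?_, isOpen_interior, hY2,
    fun z hz => (ht z).1 (interior_subset hz)⟩
  rw [tsupport, hs]
  exact (closure_minimal interior_subset hK1.isClosed).trans h1V

lemma glue {n q : ℕ} {X Y : Set (EE n)} (hX : IsCompact X) (hY : IsCompact Y) {M : ℝ}
    (hM : 0 < M) (hYM : HasM q Y M 1)
    (hK : ∀ K, IsCompact K → K ⊆ X \ Y → ∀ M > 0, HasM q K M 1) : HasM q X M 28 := by
  obtain ⟨V, φ, hV, hYV, hφ, hφr, hφT⟩ := hYM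
  obtain ⟨χ₁, O₁, hχ₁, hr₁, hs₁, hO₁, hYO₁, h1₁⟩ := cutoff hY hV hYV
  obtain ⟨χ₂, O₂, hχ₂, hr₂, hs₂, hO₂, hYO₂, h1₂⟩ := cutoff hY hO₁ hYO₁
  have hO₁V : O₁ ⊆ V := fun z hz => hs₁ (subset_tsupport _ (by simp [h1₁ z hz]))
  have hO₂₁ : O₂ ⊆ O₁ := fun z hz => hs₂ (subset_tsupport _ (by simp [h1₂ z hz]))
  set f : EE n → ℝ := fun w => χ₁ w * φ w with hfdef
  have hf : ContDiff ℝ 2 f := by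
    rw [contDiff_iff_contDiffAt]
    intro z
    by_cases hz : z ∈ tsupport χ₁
    · exact hχ₁.contDiffAt.mul (hφ.contDiffAt (hV.mem_nhds (hs₁ hz)))
    · have : f =ᶠ[nhds z] fun _ => 0 := by
        filter_upwards [(isClosed_tsupport χ₁).isOpen_compl.mem_nhds hz] with w hw
        simp [hfdef, image_eq_zero_of_notMem_tsupport hw]
      exact contDiffAt_const.congr_of_eventuallyEq this
  have hfr : ∀ z, f z ∈ Set.Icc (0 : ℝ) 1 := by
    intro z
    by_cases hz : z ∈ tsupport χ₁
    · have a := hφr z (hs₁ hz)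
      have b := hr₁ z
      exact ⟨mul_nonneg b.1 a.1, mul_le_one₀ b.2 a.1 a.2⟩
    · simp [hfdef, image_eq_zero_of_notMem_tsupport hz]
  have hfφ : ∀ z ∈ O₁, f =ᶠ[nhds z] φ := by
    intro z hz
    filter_upwards [hO₁.mem_nhds hz] with w hw
    simp [hfdef, h1₁ w hw]
  set η : EE n → ℝ := fun w => 2 - 3 * χ₂ w with hηdef
  have hη : ContDiff ℝ 2 η := contDiff_const.sub (contDiff_const.mul hχ₂)
  obtain ⟨R, hR⟩ := hX.isBounded.subset_ball (0 : EE n)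
  have hBc : IsCompact (closedBall (0 : EE n) R) := isCompact_closedBall _ _
  obtain ⟨C₁, hC₁, hb₁⟩ := TT_bound q hf hBc
  obtain ⟨C₂, hC₂, hb₂⟩ := TT_bound q hη hBc
  obtain ⟨W, ψ, hW, hKW, hψ, hψr, hψT⟩ := hK (X \ O₂) (hX.diff hO₂)
    (Set.diff_subset_diff_right hYO₂) (M + C₁ + C₂) (by positivity)
  set g : EE n → ℝ := fun w => ψ w + η w with hgdef
  classical
  set Φ : EE n → ℝ := fun w => f w + if w ∈ W then kk (g w) else 0 with hΦdef
  have hΦ2 : ∀ z ∈ O₂, Φ =ᶠ[nhds z] φ := by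
    intro z hz
    filter_upwards [hO₂.mem_nhds hz] with w hw
    have e1 : f w = φ w := by simp [hfdef, h1₁ w (hO₂₁ hw)]
    simp only [hΦdef]
    rw [e1]
    split_ifs with hwW
    · have : g w ≤ 0 := by
        have := (hψr w hwW).2
        simp only [hgdef, hηdef, h1₂ w hw]
        linarith
      simp [kk, max_eq_right this]
    · simp
  have hΦW : ∀ z ∈ W, Φ =ᶠ[nhds z] fun w => f w + kk (g w) := by
    intro z hz
    filter_upwards [hW.mem_nhds hz] with w hw
    simp [hΦdef, hw]
  have hgC : ∀ z ∈ W, ContDiffAt ℝ 2 g z := fun z hz =>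
    (hψ.contDiffAt (hW.mem_nhds hz)).add hη.contDiffAt
  have hkC : ∀ z ∈ W, ContDiffAt ℝ 2 (fun w => kk (g w)) z := fun z hz =>
    (kk_contDiff.contDiffAt).comp z (hgC z hz)
  refine ⟨(O₂ ∪ W) ∩ ball 0 R, Φ, (hO₂.union hW).inter isOpen_ball, ?_, ?_, ?_, ?_⟩
  · intro x hx
    refine ⟨?_, hR hx⟩
    by_cases h : x ∈ O₂
    · exact Or.inl h
    · exact Or.inr (hKW ⟨hx, h⟩)
  · rintro z ⟨hz | hz, -⟩
    · exact ((hφ.contDiffAt (hV.mem_nhds (hO₁V (hO₂₁ hz)))).congr_of_eventuallyEq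
        (hΦ2 z hz)).contDiffWithinAt
    · exact ((hf.contDiffAt.add (hkC z hz)).congr_of_eventuallyEq (hΦW z hz)).contDiffWithinAt
  · rintro z -
    have a := hfr z
    have b : (if z ∈ W then kk (g z) else 0) ∈ Set.Icc (0 : ℝ) 27 := by
      split_ifs with hz
      · have h3 : max (g z) 0 ≤ 3 := by
          refine max_le ?_ (by norm_num)
          have := (hψr z hz).2
          have := (hr₂ z).1
          simp only [hgdef, hηdef]
          linarith
        refine ⟨pow_nonneg (le_max_right _ _) 3, ?_⟩
        have := pow_le_pow_left₀ (le_max_right (g z) 0) h3 3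
        unfold kk
        linarith
      · norm_num
    simp only [hΦdef]
    exact ⟨add_nonneg a.1 b.1, by linarith [a.2, b.2]⟩
  · rintro z ⟨hz | hz, hzR⟩
    · exact TT_congr (hΦ2 z hz) (hφT z (hO₁V (hO₂₁ hz)))
    · have hzB := ball_subset_closedBall hzR
      have hg : TT q g z (M + C₁) := by
        have := TT_add (hψ.contDiffAt (hW.mem_nhds hz)) hη.contDiffAt (hψT z hz) (hb₂ z hzB)
        exact TT_mono (by linarith) this
      have hk := TT_comp kk_deriv kk1_deriv (fun t => by unfold kk1; positivity)
        (fun t => by unfold kk2; positivity) (hgC z hz) hg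
      refine TT_congr (hΦW z hz) ?_
      have hk1 : 0 ≤ kk1 (g z) := by unfold kk1; positivity
      by_cases hzO : z ∈ O₁
      · refine TT_mono ?_ (TT_add hf.contDiffAt (hkC z hz)
          (TT_congr (hfφ z hzO) (hφT z (hO₁V hzO))) hk)
        have : 0 ≤ kk1 (g z) * (M + C₁) := by positivity
        linarith
      · refine TT_mono ?_ (TT_add hf.contDiffAt (hkC z hz) (hb₁ z hzB) hk)
        have h2 : χ₂ z = 0 := image_eq_zero_of_notMem_tsupport fun h => hzO (hs₂ h)
        have hg2 : 2 ≤ max (g z) 0 := by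
          refine le_max_of_le_left ?_
          have := (hψr z hz).1
          simp only [hgdef, hηdef, h2]
          linarith
        have : 1 ≤ kk1 (g z) := by unfold kk1; nlinarith
        nlinarith

lemma glueP {n q : ℕ} {X Y : Set (EE n)} (hX : IsCompact X) (hY : IsCompact Y)
    (hYM : ∀ M > 0, HasM q Y M 1)
    (hK : ∀ K, IsCompact K → K ⊆ X \ Y → ∀ M > 0, HasM q K M 1) : ∀ M > 0, HasM q X M 1 :=
  fun M hM => HasM_scale (c := 28) (by norm_num)
    (glue hX hY (by positivity) (hYM (28 * M) (by positivity)) hK)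

lemma HasM_mono {n q : ℕ} {X Y : Set (EE n)} {M c : ℝ} (h : X ⊆ Y) (H : HasM q Y M c) :
    HasM q X M c := by
  obtain ⟨U, φ, hU, hX, hr⟩ := H
  exact ⟨U, φ, hU, h.trans hX, hr⟩

lemma HasM_empty {n q : ℕ} {M : ℝ} : HasM q (∅ : Set (EE n)) M 1 :=
  ⟨∅, fun _ => 0, isOpen_empty, subset_rfl, by simp, by simp, by simp⟩

lemma local_to_global {n q : ℕ} {K : Set (EE n)} (hK : IsCompact K)
    (h : ∀ x ∈ K, ∃ r > 0, ∀ M > 0, HasM q (K ∩ closedBall x r) M 1) : ∀ M > 0, HasM q K M 1 := by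
  have key : ∃ L, IsCompact L ∧ K ⊆ L ∧ ∀ M > 0, HasM q L M 1 := by
    refine hK.induction_on (p := fun S => ∃ L, IsCompact L ∧ S ⊆ L ∧ ∀ M > 0, HasM q L M 1)
      ⟨∅, isCompact_empty, subset_rfl, fun _ _ => HasM_empty⟩ ?_ ?_ ?_
    · rintro s t hst ⟨L, hL, htL, H⟩
      exact ⟨L, hL, hst.trans htL, H⟩
    · rintro s t ⟨L, hL, hsL, H⟩ ⟨L', hL', htL, H'⟩
      refine ⟨L ∪ L', hL.union hL', Set.union_subset_union hsL htL,
        glueP (hL.union hL') hL H fun S _ hS M hM => HasM_mono ?_ (H' M hM)⟩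
      intro x hx
      have := hS hx
      exact this.1.resolve_left this.2
    · intro x hx
      obtain ⟨r, hr, H⟩ := h x hx
      exact ⟨K ∩ closedBall x r, Filter.inter_mem self_mem_nhdsWithin
        (mem_nhdsWithin_of_mem_nhds (closedBall_mem_nhds x hr)),
        _, hK.inter_right isClosed_closedBall, subset_rfl, H⟩
  obtain ⟨L, -, hKL, H⟩ := key
  exact fun M hM => HasM_mono hKL (H M hM)

lemma baire_step {n q : ℕ} {X : Set (EE n)} (hX : IsCompact X) {Xk : ℕ → Set (EE n)}
    (hXk : ∀ k, IsCompact (Xk k)) (hP : ∀ k, ∀ M > 0, HasM q (Xk k) M 1)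
    (hunion : X = ⋃ k, Xk k) : ∀ M > 0, HasM q X M 1 := by
  apply local_to_global hX
  by_contra hcon
  push Not at hcon
  obtain ⟨G, hGm⟩ : ∃ G : Set (EE n), ∀ x, x ∈ G ↔
      ∃ r > 0, ∀ M > 0, HasM q (X ∩ closedBall x r) M 1 := ⟨{x | _}, fun x => Iff.rfl⟩
  have hG : IsOpen G := by
    rw [Metric.isOpen_iff]
    intro x hx
    obtain ⟨r, hr, H⟩ := (hGm x).1 hx
    refine ⟨r / 2, by positivity, fun y hy => (hGm y).2 ⟨r / 2, by positivity, fun M hM => ?_⟩⟩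
    refine HasM_mono (Set.inter_subset_inter_right _ ?_) (H M hM)
    refine closedBall_subset_closedBall' ?_
    have := mem_ball.1 hy
    linarith
  have hKG : ∀ K, IsCompact K → K ⊆ X ∩ G → ∀ M > 0, HasM q K M 1 := by
    intro K hK hKs
    refine local_to_global hK fun x hx => ?_
    obtain ⟨r, hr, H⟩ := (hGm x).1 (hKs hx).2
    exact ⟨r, hr, fun M hM => HasM_mono
      (Set.inter_subset_inter_left _ (hKs.trans Set.inter_subset_left)) (H M hM)⟩
  have hY : IsCompact (X \ G) := hX.diff hG
  have hne : (X \ G).Nonempty := by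
    obtain ⟨x, hx, h⟩ := hcon
    refine ⟨x, hx, fun hxG => ?_⟩
    obtain ⟨r, hr, H⟩ := (hGm x).1 hxG
    obtain ⟨M, hM, h'⟩ := h r hr
    exact h' (H M hM)
  have : CompactSpace (X \ G : Set (EE n)) := isCompact_iff_compactSpace.1 hY
  have : Nonempty (X \ G : Set (EE n)) := hne.to_subtype
  obtain ⟨k, ⟨y, hyX⟩, hy⟩ := nonempty_interior_of_iUnion_of_closed
    (X := (X \ G : Set (EE n))) (f := fun k => Subtype.val ⁻¹' (Xk k))
    (fun k => (hXk k).isClosed.preimage continuous_subtype_val) (by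
      rw [← Set.preimage_iUnion, ← hunion]
      exact Set.eq_univ_of_forall fun y => y.2.1)
  rw [mem_interior_iff_mem_nhds, Metric.nhds_basis_closedBall.mem_iff] at hy
  obtain ⟨r, hr, hball⟩ := hy
  refine hyX.2 ((hGm y).2 ⟨r, hr, ?_⟩)
  refine glueP (Y := (X \ G) ∩ closedBall y r) (hX.inter_right isClosed_closedBall)
    (hY.inter_right isClosed_closedBall) (fun M hM => HasM_mono ?_ (hP k M hM)) ?_
  · rintro w ⟨hw, hwb⟩
    have hm : (⟨w, hw⟩ : (X \ G : Set (EE n))) ∈ closedBall (⟨y, hyX⟩ : (X \ G : Set (EE n))) r := by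
      rw [mem_closedBall, Subtype.dist_eq]
      exact mem_closedBall.1 hwb
    exact hball hm
  · intro K hK hKs
    refine hKG K hK fun x hx => ?_
    have := hKs hx
    refine ⟨this.1.1, ?_⟩
    by_contra hxG
    exact this.2 ⟨⟨this.1.1, hxG⟩, this.1.2⟩

/-- If a compact set `X ⊆ ℂⁿ` is a countable union of compact sets each satisfying
Property `(P_q)`, then `X` satisfies Property `(P_q)`. -/
theorem countable_union_of_propertyPq (n q : ℕ) (hq : 1 ≤ q) (hqn : q ≤ n)
    (X : Set (EuclideanSpace ℂ (Fin n))) (hX : IsCompact X)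
    (Xk : ℕ → Set (EuclideanSpace ℂ (Fin n)))
    (hXk : ∀ k, IsCompact (Xk k)) (hPq : ∀ k, HasPropertyPq n q (Xk k))
    (hunion : X = ⋃ k, Xk k) :
    HasPropertyPq n q X := by
  rw [pq_iff hq hqn]
  exact baire_step hX hXk (fun k => (pq_iff hq hqn _).1 (hPq k)) hunion

end
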